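/- Let p ≥ 1 be an integer, let G be a simple graph in which every path has at most p vertices, and let H be the clique substitution of G. Then H is simultaneously P_{2p+1}-free, claw-free, butterfly-free, C_4-free, and C_5-free. -/

import Mathlib

/-- The claw `K_{1,3}`: the star on four vertices with center `0`. -/
def claw : SimpleGraph (Fin 4) := SimpleGraph.fromRel (fun i _ => i = 0)

/-- The butterfly: two triangles `{0,1,2}` and `{0,3,4}` sharing the vertex `0`. -/
def butterfly : SimpleGraph (Fin 5) :=
  SimpleGraph.fromRel (fun i j => i = 0 ∨ (i = 1 ∧ j = 2) ∨ (i = 3 ∧ j = 4))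

/-- The clique substitution of a simple graph `G`: the vertex set is
`{(v,u) : v ∈ V(G), u ∈ N_G(v)}`; two distinct vertices are adjacent iff they
have the same first coordinate (the cliques `K^v`), or they are `(u,v)` and
`(v,u)` for an edge `uv` of `G`. -/
def cliqueSub {V : Type*} (G : SimpleGraph V) :
    SimpleGraph {p : V × V // G.Adj p.1 p.2} :=
  SimpleGraph.fromRel (fun a b => a.1.1 = b.1.1 ∨ (a.1.1 = b.1.2 ∧ a.1.2 = b.1.1))

/-- A graph is `H`-free if it contains no induced subgraph isomorphic to `H`,
i.e. there is no graph embedding of `H` into it. -/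
def InducedFree {W V : Type*} (H : SimpleGraph W) (G : SimpleGraph V) : Prop :=
  IsEmpty (H ↪g G)

theorem cliqueSub_adj {V : Type*} {G : SimpleGraph V} {a b : {p : V × V // G.Adj p.1 p.2}} :
    (cliqueSub G).Adj a b ↔
      a ≠ b ∧ (a.1.1 = b.1.1 ∨ (a.1.1 = b.1.2 ∧ a.1.2 = b.1.1)) := by
  simp only [cliqueSub, SimpleGraph.fromRel_adj]
  grind

theorem claw_free_cliqueSub {V : Type*} (G : SimpleGraph V) :
    InducedFree claw (cliqueSub G) := by
  refine ⟨fun f => ?_⟩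
  have h i j := f.map_adj_iff (v := i) (w := j)
  simp only [cliqueSub_adj, ne_eq, f.injective.eq_iff] at h
  have h01 := (h 0 1).2 (by simp [claw])
  have h02 := (h 0 2).2 (by simp [claw])
  have h03 := (h 0 3).2 (by simp [claw])
  have h12 := mt (h 1 2).1 (by simp [claw])
  have h13 := mt (h 1 3).1 (by simp [claw])
  have h23 := mt (h 2 3).1 (by simp [claw])
  simp at h01 h02 h03 h12 h13 h23
  grind

theorem butterfly_free_cliqueSub {V : Type*} (G : SimpleGraph V) :
    InducedFree butterfly (cliqueSub G) := by
  refine ⟨fun f => ?_⟩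
  have h i j := f.map_adj_iff (v := i) (w := j)
  have e12 : ((f 1).1.1, (f 1).1.2) ≠ ((f 2).1.1, (f 2).1.2) :=
    fun e => by simpa using f.injective (Subtype.ext e)
  have e34 : ((f 3).1.1, (f 3).1.2) ≠ ((f 4).1.1, (f 4).1.2) :=
    fun e => by simpa using f.injective (Subtype.ext e)
  simp only [cliqueSub_adj, ne_eq, f.injective.eq_iff] at h
  have h01 := (h 0 1).2 (by simp [butterfly])
  have h02 := (h 0 2).2 (by simp [butterfly])
  have h03 := (h 0 3).2 (by simp [butterfly])
  have h04 := (h 0 4).2 (by simp [butterfly])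
  have h13 := mt (h 1 3).1 (by simp [butterfly])
  have h14 := mt (h 1 4).1 (by simp [butterfly])
  have h23 := mt (h 2 3).1 (by simp [butterfly])
  have h24 := mt (h 2 4).1 (by simp [butterfly])
  simp at h01 h02 h03 h04 h13 h14 h23 h24
  grind

theorem cycleGraph_four_free_cliqueSub {V : Type*} (G : SimpleGraph V) :
    InducedFree (SimpleGraph.cycleGraph 4) (cliqueSub G) := by
  refine ⟨fun f => ?_⟩
  have h i j := f.map_adj_iff (v := i) (w := j)
  simp only [cliqueSub_adj, ne_eq, f.injective.eq_iff] at h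
  have n i := (f i).2.ne
  have h01 := (h 0 1).2 (by decide)
  have h12 := (h 1 2).2 (by decide)
  have h23 := (h 2 3).2 (by decide)
  have h30 := (h 3 0).2 (by decide)
  have h02 := mt (h 0 2).1 (by decide)
  have h13 := mt (h 1 3).1 (by decide)
  have n0 := n 0
  have n1 := n 1
  have n2 := n 2
  have n3 := n 3
  simp at h01 h12 h23 h30 h02 h13
  grind

theorem cycleGraph_five_free_cliqueSub {V : Type*} (G : SimpleGraph V) :
    InducedFree (SimpleGraph.cycleGraph 5) (cliqueSub G) := by
  refine ⟨fun f => ?_⟩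
  have h i j := f.map_adj_iff (v := i) (w := j)
  simp only [cliqueSub_adj, ne_eq, f.injective.eq_iff] at h
  have h01 := (h 0 1).2 (by decide)
  have h12 := (h 1 2).2 (by decide)
  have h23 := (h 2 3).2 (by decide)
  have h34 := (h 3 4).2 (by decide)
  have h40 := (h 4 0).2 (by decide)
  have h02 := mt (h 0 2).1 (by decide)
  have h13 := mt (h 1 3).1 (by decide)
  have h24 := mt (h 2 4).1 (by decide)
  have h30 := mt (h 3 0).1 (by decide)
  have h41 := mt (h 4 1).1 (by decide)
  have n i := (f i).2.ne
  have n0 := n 0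
  have n1 := n 1
  have n2 := n 2
  have n3 := n 3
  have n4 := n 4
  simp at h01 h12 h23 h34 h40 h02 h13 h24 h30 h41
  grind

/-- A sequence of vertices that moves along edges or stays put, and in which equal entries are
at distance at most one, traces out a path on at least half as many vertices. -/
theorem exists_isPath_of_lazy_walk {V : Type*} (G : SimpleGraph V) (x : ℕ → V) (n : ℕ)
    (hstep : ∀ i < n, x i = x (i + 1) ∨ G.Adj (x i) (x (i + 1)))
    (hrep : ∀ i j, i ≤ j → j ≤ n → x i = x j → j ≤ i + 1) :
    ∃ w : G.Walk (x n) (x 0), w.IsPath ∧ (∀ v ∈ w.support, ∃ i ≤ n, x i = v) ∧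
      n + 1 ≤ 2 * (w.length + 1) ∧
      (n + 2 ≤ 2 * (w.length + 1) ∨ ∃ m, n = m + 1 ∧ x m = x n) := by
  induction n with
  | zero => exact ⟨.nil, by simp⟩
  | succ n ih =>
    obtain ⟨w, hw, hs, hl, hl'⟩ := ih (fun i hi => hstep i (by omega))
      (fun i j hij hj => hrep i j hij (by omega))
    by_cases heq : x n = x (n + 1)
    · refine ⟨w.copy heq rfl, by simpa using hw, ?_, ?_, Or.inr ⟨n, rfl, heq⟩⟩
      · intro v hv
        rw [SimpleGraph.Walk.support_copy] at hv
        obtain ⟨i, hi, rfl⟩ := hs v hv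
        exact ⟨i, by omega, rfl⟩
      · rw [SimpleGraph.Walk.length_copy]
        rcases hl' with hl' | ⟨m, rfl, hm⟩
        · omega
        · have := hrep m (m + 1 + 1) (by omega) le_rfl (hm.trans heq)
          omega
    · have hadj := ((hstep n (by omega)).resolve_left heq).symm
      refine ⟨.cons hadj w, hw.cons fun hmem => ?_, ?_, ?_, Or.inl ?_⟩
      · obtain ⟨i, hi, hxi⟩ := hs _ hmem
        have := hrep i (n + 1) (by omega) le_rfl hxi
        obtain rfl : i = n := by omega
        exact heq hxi
      · intro v hv
        rw [SimpleGraph.Walk.support_cons, List.mem_cons] at hv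
        rcases hv with rfl | hv
        · exact ⟨n + 1, le_rfl, rfl⟩
        · obtain ⟨i, hi, rfl⟩ := hs v hv
          exact ⟨i, by omega, rfl⟩
      all_goals
        rw [SimpleGraph.Walk.length_cons]
        omega

theorem pathGraph_free_cliqueSub {V : Type*} (G : SimpleGraph V) (p : ℕ)
    (hpath : ∀ (a b : V) (w : G.Walk a b), w.IsPath → w.length + 1 ≤ p) :
    InducedFree (SimpleGraph.pathGraph (2 * p + 1)) (cliqueSub G) := by
  refine ⟨fun f => ?_⟩
  let x : ℕ → V := fun i => (f (Fin.ofNat (2 * p + 1) i)).1.1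
  have hstep : ∀ i < 2 * p, x i = x (i + 1) ∨ G.Adj (x i) (x (i + 1)) := by
    intro i hi
    have hadj : (cliqueSub G).Adj (f (Fin.ofNat (2 * p + 1) i))
        (f (Fin.ofNat (2 * p + 1) (i + 1))) := by
      rw [f.map_adj_iff, SimpleGraph.pathGraph_adj]
      simp only [Fin.ofNat]
      rw [Nat.mod_eq_of_lt (by omega), Nat.mod_eq_of_lt (by omega)]
      exact Or.inl rfl
    rw [cliqueSub_adj] at hadj
    refine hadj.2.imp_right fun h => ?_
    have := (f (Fin.ofNat (2 * p + 1) i)).2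
    rwa [h.2] at this
  have hrep : ∀ i j, i ≤ j → j ≤ 2 * p → x i = x j → j ≤ i + 1 := by
    intro i j hij hj h
    by_contra hlt
    have hne : Fin.ofNat (2 * p + 1) i ≠ Fin.ofNat (2 * p + 1) j := by
      simp only [Fin.ofNat, ne_eq, Fin.mk.injEq]
      rw [Nat.mod_eq_of_lt (by omega), Nat.mod_eq_of_lt (by omega)]
      omega
    have hadj := cliqueSub_adj.2 ⟨f.injective.ne hne, Or.inl h⟩
    rw [f.map_adj_iff, SimpleGraph.pathGraph_adj] at hadj
    simp only [Fin.ofNat] at hadj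
    rw [Nat.mod_eq_of_lt (by omega), Nat.mod_eq_of_lt (by omega)] at hadj
    omega
  obtain ⟨w, hw, -, hl, -⟩ := exists_isPath_of_lazy_walk G x (2 * p) hstep hrep
  have := hpath _ _ w hw
  omega

theorem stmt_10 {V : Type*} (G : SimpleGraph V) (p : ℕ) (hp : 1 ≤ p)
    (hpath : ∀ (a b : V) (w : G.Walk a b), w.IsPath → w.length + 1 ≤ p) :
    InducedFree (SimpleGraph.pathGraph (2 * p + 1)) (cliqueSub G) ∧
      InducedFree claw (cliqueSub G) ∧
      InducedFree butterfly (cliqueSub G) ∧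
      InducedFree (SimpleGraph.cycleGraph 4) (cliqueSub G) ∧
      InducedFree (SimpleGraph.cycleGraph 5) (cliqueSub G) := by
  exact ⟨pathGraph_free_cliqueSub G p hpath, claw_free_cliqueSub G, butterfly_free_cliqueSub G,
    cycleGraph_four_free_cliqueSub G, cycleGraph_five_free_cliqueSub G⟩
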